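/- Let φ > 1 be a smooth, even function on 𝕊ⁿ with A[φ] ≥ 0 (for example the horospherical support function of a smooth origin-symmetric uniformly h-convex bounded domain in hyperbolic space, or an even h-convex solution of the horospherical p-Christoffel–Minkowski equation). Then (1/2)(max_{𝕊ⁿ} φ + 1/max_{𝕊ⁿ} φ) ≤ min_{𝕊ⁿ} φ. -/

import Mathlib

open scoped RealInnerProductSpace
open Finset

noncomputable section

/-- Euclidean space `ℝ^(n+1)`, the ambient space of the unit sphere `𝕊ⁿ`. -/
abbrev Euc (n : ℕ) : Type := EuclideanSpace ℝ (Fin (n + 1))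

/-- The unit sphere `𝕊ⁿ ⊆ ℝ^(n+1)`. -/
def uSphere (n : ℕ) : Set (Euc n) := Metric.sphere (0 : Euc n) 1

/-- Orthogonal projection onto the tangent space of the sphere at (the normalization of) `x`. -/
def tanProj {n : ℕ} (x v : Euc n) : Euc n := v - (⟪x, v⟫ / ‖x‖ ^ 2) • x

/-- `f` is (the 0-homogeneous extension of) a function on the sphere. -/
def Homog0 {n : ℕ} (f : Euc n → ℝ) : Prop := ∀ (c : ℝ) (y : Euc n), 0 < c → f (c • y) = f y

/-- Smoothness of a function on the sphere, expressed via its 0-homogeneous extension. -/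
def SmoothFn {n : ℕ} (f : Euc n → ℝ) : Prop := ContDiffOn ℝ (⊤ : ℕ∞) f {y : Euc n | y ≠ 0}

/-- `f(x) = f(-x)` for all `x`. -/
def EvenFn {n : ℕ} (f : Euc n → ℝ) : Prop := ∀ y, f (-y) = f y

/-- Covariant (tangential) derivative of a function on the sphere, in direction `v`. -/
def covD {n : ℕ} (f : Euc n → ℝ) (x v : Euc n) : ℝ := fderiv ℝ f x (tanProj x v)

/-- Spherical (tangential) gradient. -/
def gradS {n : ℕ} (f : Euc n → ℝ) (x : Euc n) : Euc n := tanProj x (gradient f x)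

/-- Covariant Hessian `(D²f)(v,w)` of a function on the round sphere. -/
def hessS {n : ℕ} (f : Euc n → ℝ) (x v w : Euc n) : ℝ :=
  fderiv ℝ (fun y => covD f y w) x (tanProj x v)

/-- The symmetric 2-tensor
`A[φ](v,w) = (D²φ)(v,w) - (|Dφ|²/(2φ)) σ(v,w) + ((φ - 1/φ)/2) σ(v,w)` on the sphere. -/
def Aform {n : ℕ} (φ : Euc n → ℝ) (x v w : Euc n) : ℝ :=
  hessS φ x v w +
    ((φ x - (φ x)⁻¹) / 2 - ‖gradS φ x‖ ^ 2 / (2 * φ x)) * ⟪tanProj x v, tanProj x w⟫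

/-- `φ` is h-convex: `A[φ] ≥ 0` on the sphere. -/
def HConvex {n : ℕ} (φ : Euc n → ℝ) : Prop :=
  ∀ x ∈ uSphere n, ∀ v : Euc n, ⟪x, v⟫ = 0 → 0 ≤ Aform φ x v v

/-- `φ` is uniformly h-convex: `A[φ] > 0` on the sphere. -/
def UnifHConvex {n : ℕ} (φ : Euc n → ℝ) : Prop :=
  ∀ x ∈ uSphere n, ∀ v : Euc n, ⟪x, v⟫ = 0 → v ≠ 0 → 0 < Aform φ x v v

/-- `σ_k` of a square matrix: the sum of its principal `k × k` minors
(equivalently, the `k`-th elementary symmetric function of its eigenvalues). -/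
def sigmaMat {N : ℕ} (k : ℕ) (M : Matrix (Fin N) (Fin N) ℝ) : ℝ :=
  ∑ s ∈ Finset.powersetCard k (Finset.univ : Finset (Fin N)),
    Matrix.det (Matrix.of fun i j : {a : Fin N // a ∈ s} => M i.1 j.1)

/-- `e` is an orthonormal frame of the tangent space of `𝕊ⁿ` at `x`. -/
def OrthoFrame {n : ℕ} (x : Euc n) (e : Fin n → Euc n) : Prop :=
  (∀ i, ⟪x, e i⟫ = 0) ∧ ∀ i j, ⟪e i, e j⟫ = if i = j then 1 else 0

/-- The matrix of `A[φ]` at `x` with respect to an orthonormal tangent frame `e`. -/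
def Amat {n : ℕ} (φ : Euc n → ℝ) (x : Euc n) (e : Fin n → Euc n) : Matrix (Fin n) (Fin n) ℝ :=
  Matrix.of fun i j => Aform φ x (e i) (e j)

/-- `φ` solves the horospherical `p`-Christoffel-Minkowski equation
`σ_k(A[φ]) = φ^(p-k) f` on `𝕊ⁿ`. -/
def SolvesCM (n k : ℕ) (p : ℝ) (f φ : Euc n → ℝ) : Prop :=
  ∀ x ∈ uSphere n, ∀ e : Fin n → Euc n, OrthoFrame x e →
    sigmaMat k (Amat φ x e) = φ x ^ (p - (k : ℝ)) * f x

/-- Supremum (maximum) of a function over the sphere. -/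
def sphSup {n : ℕ} (f : Euc n → ℝ) : ℝ := sSup (f '' uSphere n)

/-- Infimum (minimum) of a function over the sphere. -/
def sphInf {n : ℕ} (f : Euc n → ℝ) : ℝ := sInf (f '' uSphere n)

/-- The function `f^(-1/q)`. -/
def negPowExt {n : ℕ} (f : Euc n → ℝ) (q : ℝ) : Euc n → ℝ := fun y => f y ^ (-(1 / q))

/-- Assumption 1.3 of the paper (Assumption (A)): the gradient-and-Hessian conditions on the
prescribed function `f`, according to the value of `p`. -/
def AssumptionA (n k : ℕ) (p : ℝ) (f : Euc n → ℝ) : Prop :=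
  ((p = 0) →
    ∀ x ∈ uSphere n, ∀ v : Euc n, ⟪x, v⟫ = 0 →
      0 ≤ hessS (negPowExt f (k : ℝ)) x v v - ‖gradS (negPowExt f (k : ℝ)) x‖ * ‖v‖ ^ 2 +
          negPowExt f (k : ℝ) x /
              (2 + 8 * sphSup fun y => (f y / (n.choose k : ℝ)) ^ (1 / (k : ℝ))) * ‖v‖ ^ 2) ∧
  ((0 < p ∧ p ≤ (k : ℝ) / 2) →
    ∀ x ∈ uSphere n, ∀ v : Euc n, ⟪x, v⟫ = 0 →
      0 ≤ hessS (negPowExt f (k : ℝ)) x v v -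
            (((k : ℝ) + 2 * p) / (k : ℝ)) * ‖gradS (negPowExt f (k : ℝ)) x‖ * ‖v‖ ^ 2 +
          (p ^ 2 / (k : ℝ) ^ 2) * negPowExt f (k : ℝ) x * ‖v‖ ^ 2) ∧
  (((k : ℝ) / 2 < p ∧ p < (k : ℝ)) →
    ∀ x ∈ uSphere n, ∀ v : Euc n, ⟪x, v⟫ = 0 →
      0 ≤ hessS (negPowExt f (k : ℝ)) x v v -
            ((3 * (k : ℝ) - 2 * p) ^ 2 / (p * (2 * p - (k : ℝ)))) *
              (‖gradS (negPowExt f (k : ℝ)) x‖ ^ 2 / (2 * negPowExt f (k : ℝ) x)) * ‖v‖ ^ 2 +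
          (p / (2 * (k : ℝ))) * negPowExt f (k : ℝ) x * ‖v‖ ^ 2) ∧
  (((k : ℝ) ≤ p ∧ p < 2 * (k : ℝ)) →
    ∀ x ∈ uSphere n, ∀ v : Euc n, ⟪x, v⟫ = 0 →
      0 ≤ hessS (negPowExt f p) x v v -
            (‖gradS (negPowExt f p) x‖ ^ 2 / (2 * negPowExt f p x)) * ‖v‖ ^ 2 +
          (1 / 2) * negPowExt f p x * ‖v‖ ^ 2) ∧
  ((p = 2 * (k : ℝ)) →
    sphSup f < (n.choose k : ℝ) / 2 ^ k ∧
    ∀ x ∈ uSphere n, ∀ v : Euc n, ⟪x, v⟫ = 0 →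
      0 ≤ hessS (negPowExt f p) x v v -
            (‖gradS (negPowExt f p) x‖ ^ 2 / (2 * negPowExt f p x)) * ‖v‖ ^ 2 +
          (1 / 2) * negPowExt f p x * ‖v‖ ^ 2) ∧
  ((2 * (k : ℝ) < p) →
    2 ≤ k ∧
    sphInf f ≤
      (k : ℝ) ^ k * (p - 2 * (k : ℝ)) ^ ((p - 2 * (k : ℝ)) / 2) / p ^ (p / 2) * (n.choose k : ℝ) ∧
    ∀ x ∈ uSphere n, ∀ v : Euc n, ⟪x, v⟫ = 0 →
      0 ≤ hessS (negPowExt f p) x v v -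
            (‖gradS (negPowExt f p) x‖ ^ 2 / (2 * negPowExt f p x)) * ‖v‖ ^ 2 +
          ((k : ℝ) / p) * negPowExt f p x * ‖v‖ ^ 2)

/-- A one-dimensional h-convex function with a critical point at `0` has derivative at least `-f` on
`[0, π / 2]`. -/
theorem neg_le_deriv_of_hconvex {f f₁ f₂ : ℝ → ℝ}
    (hf : ∀ t, HasDerivAt f (f₁ t) t) (hf₁ : ∀ t, HasDerivAt f₁ (f₂ t) t)
    (hpos : ∀ t, 0 < f t) (h0 : f₁ 0 = 0)
    (hA : ∀ t, 0 ≤ f₂ t - f₁ t ^ 2 / (2 * f t) + (f t - (f t)⁻¹) / 2)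
    {t : ℝ} (ht : 0 ≤ t) (ht' : t ≤ Real.pi / 2) : -f t ≤ f₁ t := by
  have hd : ∀ t, HasDerivAt (fun t => Real.arctan (f₁ t / f t) + t / 2)
      (1 / (1 + (f₁ t / f t) ^ 2) * ((f₂ t * f t - f₁ t * f₁ t) / f t ^ 2) + 1 / 2) t :=
    fun t => (((hf₁ t).div (hf t) (hpos t).ne').arctan).add ((hasDerivAt_id t).div_const 2)
  have hmono : Monotone fun t => Real.arctan (f₁ t / f t) + t / 2 := by
    refine monotone_of_deriv_nonneg (fun t => (hd t).differentiableAt) fun t => ?_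
    rw [(hd t).deriv]
    have hp := hpos t
    have key : 1 / (1 + (f₁ t / f t) ^ 2) * ((f₂ t * f t - f₁ t * f₁ t) / f t ^ 2) + 1 / 2
        = (f t * (f₂ t - f₁ t ^ 2 / (2 * f t) + (f t - (f t)⁻¹) / 2) + 1 / 2)
          / (f t ^ 2 + f₁ t ^ 2) := by
      field_simp
      ring
    rw [key]
    have := hA t
    positivity
  have h := hmono ht
  simp only [h0, zero_div, Real.arctan_zero, add_zero] at h
  have h1 : Real.arctan (-1) ≤ Real.arctan (f₁ t / f t) := by
    rw [Real.arctan_neg, Real.arctan_one]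
    linarith
  have h2 := Real.arctan_strictMono.le_iff_le.1 h1
  rw [le_div_iff₀ (hpos t)] at h2
  linarith

/-- Comparison of a one-dimensional h-convex function having a critical point at `0` with the
model solution `t ↦ (f 0 + (f 0)⁻¹) / 2 + (f 0 - (f 0)⁻¹) / 2 * cos t`. -/
theorem half_add_inv_le_of_hconvex {f f₁ f₂ : ℝ → ℝ}
    (hf : ∀ t, HasDerivAt f (f₁ t) t) (hf₁ : ∀ t, HasDerivAt f₁ (f₂ t) t)
    (hone : ∀ t, 1 < f t) (h0 : f₁ 0 = 0)
    (hA : ∀ t, 0 ≤ f₂ t - f₁ t ^ 2 / (2 * f t) + (f t - (f t)⁻¹) / 2)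
    {θ : ℝ} (hθ : 0 ≤ θ) (hθ' : θ ≤ Real.pi / 2) : (f 0 + (f 0)⁻¹) / 2 ≤ f θ := by
  have hpos : ∀ t, 0 < f t := fun t => one_pos.trans (hone t)
  have hs : ∀ t, HasDerivAt (fun t => θ - t) (-1) t := fun t => by
    simpa using (hasDerivAt_id t).const_sub θ
  let G : ℝ → ℝ := fun t => (f₁ t ^ 2 + 1) / f t * (1 - Real.cos (θ - t)) / 2
    + f t * (1 + Real.cos (θ - t)) / 2 + f₁ t * Real.sin (θ - t)
  have hG : ∀ t, HasDerivAt G ((f₂ t - f₁ t ^ 2 / (2 * f t) + (f t - (f t)⁻¹) / 2) *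
      (f₁ t / f t * (1 - Real.cos (θ - t)) + Real.sin (θ - t))) t := fun t => by
    have hp := (hpos t).ne'
    have h1 := ((((hf₁ t).pow 2).add_const 1).div (hf t) hp).mul ((hs t).cos.const_sub 1)
    have h2 := (hf t).mul ((hs t).cos.const_add 1)
    have h3 := (hf₁ t).mul (hs t).sin
    refine (((h1.div_const 2).add (h2.div_const 2)).add h3).congr_deriv ?_
    simp
    field_simp
    ring
  have hmono : MonotoneOn G (Set.Icc 0 θ) := by
    refine monotoneOn_of_deriv_nonneg (convex_Icc 0 θ)
      (fun t _ => (hG t).continuousAt.continuousWithinAt)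
      (fun t _ => (hG t).differentiableAt.differentiableWithinAt) fun t ht => ?_
    rw [interior_Icc] at ht
    rw [(hG t).deriv]
    refine mul_nonneg (hA t) ?_
    have hv : -1 ≤ f₁ t / f t := by
      rw [le_div_iff₀ (hpos t)]
      linarith [neg_le_deriv_of_hconvex hf hf₁ hpos h0 hA ht.1.le (ht.2.le.trans hθ')]
    have hc : 0 ≤ Real.cos (θ - t) :=
      Real.cos_nonneg_of_neg_pi_div_two_le_of_le (by linarith [ht.1, ht.2, Real.pi_pos])
        (by linarith [ht.1])
    have hsn : 0 ≤ Real.sin (θ - t) :=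
      Real.sin_nonneg_of_nonneg_of_le_pi (by linarith [ht.2])
        (by linarith [ht.1, Real.pi_pos])
    have h1 := Real.cos_le_one (θ - t)
    have h2 := Real.sin_sq_add_cos_sq (θ - t)
    have h3 := Real.sin_le_one (θ - t)
    have h4 : 1 ≤ Real.sin (θ - t) + Real.cos (θ - t) := by nlinarith
    linarith [mul_le_mul_of_nonneg_right hv (sub_nonneg.2 h1)]
  have h := hmono (Set.left_mem_Icc.2 hθ) (Set.right_mem_Icc.2 hθ) hθ
  simp only [G, h0, sub_self, Real.cos_zero, Real.sin_zero, sub_zero] at h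
  have hc : 0 ≤ Real.cos θ :=
    Real.cos_nonneg_of_neg_pi_div_two_le_of_le (by linarith [Real.pi_pos]) hθ'
  have hi : (f 0)⁻¹ ≤ 1 := inv_le_one_of_one_le₀ (hone 0).le
  have hm : 0 ≤ Real.cos θ * (f 0 - (f 0)⁻¹) := mul_nonneg hc (by linarith [hone 0])
  have hd : ((0:ℝ) ^ 2 + 1) / f 0 = (f 0)⁻¹ := by simp
  rw [hd] at h
  linarith

section Sphere

variable {n : ℕ} {φ : Euc n → ℝ}

theorem SmoothFn.contDiffAt_two (hφ : SmoothFn φ) {x : Euc n} (hx : x ≠ 0) :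
    ContDiffAt ℝ 2 φ x :=
  (ContDiffOn.contDiffAt hφ (isOpen_ne.mem_nhds hx)).of_le (WithTop.coe_le_coe.2 (le_top : (2 : ℕ∞) ≤ ⊤))

theorem SmoothFn.differentiableAt_fderiv (hφ : SmoothFn φ) {x : Euc n} (hx : x ≠ 0) :
    DifferentiableAt ℝ (fderiv ℝ φ) x :=
  ((hφ.contDiffAt_two hx).fderiv_right (m := 1) (by norm_num)).differentiableAt (by norm_num)

theorem Homog0.fderiv_self (h0 : Homog0 φ) (hφ : SmoothFn φ) {x : Euc n} (hx : x ≠ 0) :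
    fderiv ℝ φ x x = 0 := by
  have h1 : HasDerivAt (fun c : ℝ => c • x) x 1 := by
    simpa using (hasDerivAt_id (1 : ℝ)).smul_const x
  have hd : HasFDerivAt φ (fderiv ℝ φ x) ((1 : ℝ) • x) := by
    rw [one_smul]
    exact ((hφ.contDiffAt_two hx).differentiableAt (by norm_num)).hasFDerivAt
  have h2 := hd.comp_hasDerivAt (1 : ℝ) h1
  have h3 : φ ∘ (fun c : ℝ => c • x) =ᶠ[nhds 1] fun _ => φ x := by
    filter_upwards [lt_mem_nhds (one_pos : (0 : ℝ) < 1)] with c hc using h0 c x hc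
  exact h2.unique ((hasDerivAt_const (1 : ℝ) (φ x)).congr_of_eventuallyEq h3)

theorem Homog0.covD_eq (h0 : Homog0 φ) (hφ : SmoothFn φ) {x : Euc n} (hx : x ≠ 0) (v : Euc n) :
    covD φ x v = fderiv ℝ φ x v := by
  simp [covD, tanProj, h0.fderiv_self hφ hx]

theorem tanProj_of_inner_eq_zero {x v : Euc n} (h : ⟪x, v⟫ = 0) : tanProj x v = v := by
  simp [tanProj, h]

theorem Homog0.hessS_eq (h0 : Homog0 φ) (hφ : SmoothFn φ) {x v : Euc n} (hx : x ≠ 0)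
    (hv : ⟪x, v⟫ = 0) (w : Euc n) :
    hessS φ x v w = fderiv ℝ (fderiv ℝ φ) x v w := by
  have h : (fun y => covD φ y w) =ᶠ[nhds x] fun y => fderiv ℝ φ y w := by
    filter_upwards [isOpen_ne.mem_nhds hx] with y hy using h0.covD_eq hφ hy w
  rw [hessS, h.fderiv_eq, tanProj_of_inner_eq_zero hv,
    ((hφ.differentiableAt_fderiv hx).hasFDerivAt.clm_apply (hasFDerivAt_const w x)).fderiv]
  simp

theorem sq_fderiv_le_sq_norm_gradS {x v : Euc n} (hv : ⟪x, v⟫ = 0) (hv1 : ‖v‖ = 1) :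
    fderiv ℝ φ x v ^ 2 ≤ ‖gradS φ x‖ ^ 2 := by
  have h : fderiv ℝ φ x v = ⟪gradS φ x, v⟫ := by
    rw [gradS, tanProj, inner_sub_left, real_inner_smul_left, hv, mul_zero, sub_zero, gradient,
      InnerProductSpace.toDual_symm_apply]
  rw [h, sq_le_sq, abs_norm]
  simpa [hv1] using abs_real_inner_le_norm (gradS φ x) v

/-- An h-convex function satisfies the one-dimensional h-convexity inequality in every unit
tangent direction. -/
theorem HConvex.fderiv_fderiv_nonneg (hc : HConvex φ) (h0 : Homog0 φ) (hφ : SmoothFn φ)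
    {x v : Euc n} (hx : ‖x‖ = 1) (hpos : 0 < φ x) (hv : ⟪x, v⟫ = 0) (hv1 : ‖v‖ = 1) :
    0 ≤ fderiv ℝ (fderiv ℝ φ) x v v - fderiv ℝ φ x v ^ 2 / (2 * φ x)
      + (φ x - (φ x)⁻¹) / 2 := by
  have hx0 : x ≠ 0 := by
    rintro rfl
    simp at hx
  have h := hc x (by simpa [uSphere] using hx) v hv
  rw [Aform, h0.hessS_eq hφ hx0 hv, tanProj_of_inner_eq_zero hv, real_inner_self_eq_norm_sq, hv1,
    one_pow, mul_one] at h
  have h2 : fderiv ℝ φ x v ^ 2 / (2 * φ x) ≤ ‖gradS φ x‖ ^ 2 / (2 * φ x) := by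
    gcongr ?_ / _
    exact sq_fderiv_le_sq_norm_gradS hv hv1
  linarith

/-- At distance at most `π / 2` from a maximum point `x`, an h-convex function is at least
`(φ x + (φ x)⁻¹) / 2`. -/
theorem HConvex.half_add_inv_le_of_greatCircle (hc : HConvex φ) (h0 : Homog0 φ)
    (hφ : SmoothFn φ) (hφ1 : ∀ x ∈ uSphere n, 1 < φ x) {x u : Euc n} (hx : ‖x‖ = 1)
    (hu : ‖u‖ = 1) (hxu : ⟪x, u⟫ = 0) (hmax : ∀ y ∈ uSphere n, φ y ≤ φ x)
    {θ : ℝ} (hθ : 0 ≤ θ) (hθ' : θ ≤ Real.pi / 2) :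
    (φ x + (φ x)⁻¹) / 2 ≤ φ (Real.cos θ • x + Real.sin θ • u) := by
  let γ : ℝ → Euc n := fun t => Real.cos t • x + Real.sin t • u
  let γ' : ℝ → Euc n := fun t => -Real.sin t • x + Real.cos t • u
  have hγ : ∀ t, HasDerivAt γ (γ' t) t := fun t =>
    ((Real.hasDerivAt_cos t).smul_const x).add ((Real.hasDerivAt_sin t).smul_const u)
  have hγ' : ∀ t, HasDerivAt γ' (-γ t) t := fun t => by
    refine (((Real.hasDerivAt_sin t).neg.smul_const x).add
      ((Real.hasDerivAt_cos t).smul_const u)).congr_deriv ?_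
    simp only [γ, neg_add, neg_smul]
  have hux : ⟪u, x⟫ = 0 := by rw [real_inner_comm, hxu]
  have hnorm : ∀ t, ‖γ t‖ = 1 := fun t => by
    rw [← sq_eq_sq₀ (norm_nonneg _) zero_le_one, ← real_inner_self_eq_norm_sq]
    simp only [γ, inner_add_left, inner_add_right, real_inner_smul_left, real_inner_smul_right,
      hxu, hux, real_inner_self_eq_norm_sq, norm_smul, hx, hu, mul_one, mul_zero,
      Real.norm_eq_abs, sq_abs]
    linarith [Real.sin_sq_add_cos_sq t]
  have hnorm' : ∀ t, ‖γ' t‖ = 1 := fun t => by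
    rw [← sq_eq_sq₀ (norm_nonneg _) zero_le_one, ← real_inner_self_eq_norm_sq]
    simp only [γ', inner_add_left, inner_add_right, real_inner_smul_left, real_inner_smul_right,
      hxu, hux, real_inner_self_eq_norm_sq, norm_smul, hx, hu, mul_one, mul_zero, norm_neg,
      Real.norm_eq_abs, sq_abs]
    linarith [Real.sin_sq_add_cos_sq t]
  have horth : ∀ t, ⟪γ t, γ' t⟫ = 0 := fun t => by
    simp only [γ, γ', inner_add_left, inner_add_right, real_inner_smul_left,
      real_inner_smul_right, hxu, hux, real_inner_self_eq_norm_sq, hx, hu]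
    ring
  have hne : ∀ t, γ t ≠ 0 := fun t h => by simpa [h] using hnorm t
  have hmem : ∀ t, γ t ∈ uSphere n := fun t => by simpa [uSphere] using hnorm t
  have hf : ∀ t, HasDerivAt (fun t => φ (γ t)) (fderiv ℝ φ (γ t) (γ' t)) t := fun t =>
    ((hφ.contDiffAt_two (hne t)).differentiableAt (by norm_num)).hasFDerivAt.comp_hasDerivAt t (hγ t)
  have hf₁ : ∀ t, HasDerivAt (fun t => fderiv ℝ φ (γ t) (γ' t))
      (fderiv ℝ (fderiv ℝ φ) (γ t) (γ' t) (γ' t)) t := fun t => by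
    refine (((hφ.differentiableAt_fderiv (hne t)).hasFDerivAt.comp_hasDerivAt t
      (hγ t)).clm_apply (hγ' t)).congr_deriv ?_
    simp [h0.fderiv_self hφ (hne t)]
  have hγ0 : γ 0 = x := by simp [γ]
  have hcrit : fderiv ℝ φ (γ 0) (γ' 0) = 0 := by
    refine IsLocalMax.hasDerivAt_eq_zero (Filter.Eventually.of_forall fun t => ?_) (hf 0)
    simpa only [hγ0] using hmax _ (hmem t)
  have h := half_add_inv_le_of_hconvex hf hf₁ (fun t => hφ1 _ (hmem t)) hcrit
    (fun t => hc.fderiv_fderiv_nonneg h0 hφ (hnorm t) (one_pos.trans (hφ1 _ (hmem t))) (horth t)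
      (hnorm' t)) hθ hθ'
  simpa only [hγ0] using h

theorem HConvex.half_add_inv_le_of_inner_nonneg (hc : HConvex φ) (h0 : Homog0 φ)
    (hφ : SmoothFn φ) (hφ1 : ∀ x ∈ uSphere n, 1 < φ x) {x y : Euc n} (hx : ‖x‖ = 1)
    (hy : ‖y‖ = 1) (hmax : ∀ y ∈ uSphere n, φ y ≤ φ x) (hxy : 0 ≤ ⟪x, y⟫) :
    (φ x + (φ x)⁻¹) / 2 ≤ φ y := by
  set c := ⟪x, y⟫ with hcdef
  have hc1 : c ≤ 1 := by simpa [hx, hy] using real_inner_le_norm x y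
  have hwsq : ‖y - c • x‖ ^ 2 = 1 - c ^ 2 := by
    rw [norm_sub_sq_real, real_inner_smul_right, real_inner_comm, ← hcdef, norm_smul, hx, hy,
      mul_one, Real.norm_eq_abs, sq_abs]
    ring
  by_cases hw : y - c • x = 0
  · have hc2 : c = 1 := by
      rw [hw, norm_zero] at hwsq
      nlinarith
    have hyx : y = x := by simpa [hc2, sub_eq_zero] using hw
    have hone := hφ1 x (by simpa [uSphere] using hx)
    rw [hyx]
    linarith [inv_le_one_of_one_le₀ hone.le]
  · have hw' : ‖y - c • x‖ ≠ 0 := norm_ne_zero_iff.2 hw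
    have hsin : Real.sin (Real.arccos c) = ‖y - c • x‖ := by
      rw [Real.sin_arccos, ← hwsq, Real.sqrt_sq (norm_nonneg _)]
    have h := hc.half_add_inv_le_of_greatCircle h0 hφ hφ1 (x := x)
      (u := ‖y - c • x‖⁻¹ • (y - c • x)) hx (norm_smul_inv_norm hw)
      (by
        rw [real_inner_smul_right, inner_sub_right, real_inner_smul_right,
          real_inner_self_eq_norm_sq, hx, ← hcdef]
        ring)
      hmax (Real.arccos_nonneg c) (Real.arccos_le_pi_div_two.2 hxy)
    rwa [Real.cos_arccos (by linarith) hc1, hsin, smul_inv_smul₀ hw', add_sub_cancel] at h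

end Sphere

/-- **Pinching inequality for even h-convex functions** (inequality (3.4) of Luo–Wei, from the
proof of Lemma 7.2 of Li–Xu): if `φ > 1` is smooth, even and h-convex (`A[φ] ≥ 0`) on `𝕊ⁿ`,
then `½(max φ + 1/max φ) ≤ min φ`. -/
theorem even_hconvex_pinching (n : ℕ) (φ : Euc n → ℝ)
    (hφ0 : Homog0 φ) (hφs : SmoothFn φ) (hφe : EvenFn φ)
    (hφ1 : ∀ x ∈ uSphere n, 1 < φ x) (hφc : HConvex φ) :
    (sphSup φ + (sphSup φ)⁻¹) / 2 ≤ sphInf φ := by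
  have hcpt : IsCompact (uSphere n) := isCompact_sphere 0 1
  have hne : (uSphere n).Nonempty := NormedSpace.sphere_nonempty.2 zero_le_one
  have hcont : ContinuousOn φ (uSphere n) := hφs.continuousOn.mono fun x hx h => by
    simp [uSphere, h] at hx
  obtain ⟨x, hx, hmax⟩ := hcpt.exists_isMaxOn hne hcont
  obtain ⟨y, hy, hmin⟩ := hcpt.exists_isMinOn hne hcont
  have hsup : sphSup φ = φ x :=
    IsGreatest.csSup_eq ⟨Set.mem_image_of_mem φ hx, Set.forall_mem_image.2 hmax⟩
  have hinf : sphInf φ = φ y :=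
    IsLeast.csInf_eq ⟨Set.mem_image_of_mem φ hy, Set.forall_mem_image.2 hmin⟩
  rw [hsup, hinf]
  have hx1 : ‖x‖ = 1 := by simpa [uSphere] using hx
  have hy1 : ‖y‖ = 1 := by simpa [uSphere] using hy
  rcases le_total 0 ⟪x, y⟫ with h | h
  · exact hφc.half_add_inv_le_of_inner_nonneg hφ0 hφs hφ1 hx1 hy1 hmax h
  · rw [← hφe y]
    exact hφc.half_add_inv_le_of_inner_nonneg hφ0 hφs hφ1 hx1 (by rwa [norm_neg]) hmax
      (by rw [inner_neg_right]; linarith)
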